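/- Let n ≥ 2 be an integer. Let Y ⊆ ℂ be the union of the unit circle {z : |z| = 1} and the real segment {z : Im z = 0, 1 ≤ Re z ≤ 2}, with the subspace topology (a model of the wedge S¹ ∨ I). Let S = ℝ/ℤ be the circle with the free ℤₙ-action x ↦ x + k/n. Then for every continuous map f : S → Y there exists a continuous map g : S → Y homotopic to f such that g(x + k/n) ≠ g(x) for all x ∈ S and all integers k with 1 ≤ k ≤ n − 1. (This is the paper's theorem that, for a source of Euler characteristic zero, the Borsuk–Ulam property fails for all homotopy classes of maps to S¹ ∨ I, in the case where the source is the circle.) -/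

import Mathlib

/-- The wedge `S¹ ∨ I`: the unit circle together with the real segment `[1, 2]`. -/
def circleWedgeSegment : Set ℂ :=
  {z : ℂ | ‖z‖ = 1} ∪ {z : ℂ | z.im = 0 ∧ 1 ≤ z.re ∧ z.re ≤ 2}

namespace circleWedgeSegment

open Set unitInterval

theorem ofReal_mem {r : ℝ} (h₁ : 1 ≤ r) (h₂ : r ≤ 2) : (r : ℂ) ∈ circleWedgeSegment :=
  Or.inr ⟨Complex.ofReal_im r, by simpa using h₁, by simpa using h₂⟩

theorem coe_circle_mem (u : Circle) : (u : ℂ) ∈ circleWedgeSegment :=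
  Or.inl u.norm_coe

theorem norm_eq_one_or_eq_ofReal {z : ℂ} (hz : z ∈ circleWedgeSegment) :
    ‖z‖ = 1 ∨ ∃ r : ℝ, 1 ≤ r ∧ r ≤ 2 ∧ z = r := by
  rcases hz with h | ⟨h₀, h₁, h₂⟩
  · exact Or.inl h
  · exact Or.inr ⟨z.re, h₁, h₂, Complex.ext rfl (by simpa using h₀)⟩

theorem ne_zero {z : ℂ} (hz : z ∈ circleWedgeSegment) : z ≠ 0 := by
  rintro rfl
  rcases hz with h | ⟨-, h, -⟩ <;> norm_num at h

/-- The radial projection of the wedge onto its circle. -/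
noncomputable def radialProj : C(circleWedgeSegment, Circle) where
  toFun z := ⟨(z : ℂ) / ‖(z : ℂ)‖, by
    refine mem_sphere_zero_iff_norm.2 ?_
    simp [ne_zero z.2]⟩
  continuous_toFun := by
    refine Continuous.subtype_mk ?_ _
    refine continuous_subtype_val.div (by fun_prop) fun z ↦ ?_
    simpa using ne_zero z.2

theorem coe_radialProj (z : circleWedgeSegment) :
    (radialProj z : ℂ) = (z : ℂ) / ‖(z : ℂ)‖ := rfl

/-- The inclusion of the circle into the wedge. -/
def ofCircle : C(Circle, circleWedgeSegment) where
  toFun u := ⟨u, coe_circle_mem u⟩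
  continuous_toFun := by fun_prop

theorem radial_segment_mem {z : ℂ} (hz : z ∈ circleWedgeSegment) (t : I) :
    (1 - (t : ℂ)) * z + t * (z / ‖z‖) ∈ circleWedgeSegment := by
  rcases norm_eq_one_or_eq_ofReal hz with h | ⟨r, h₁, h₂, rfl⟩
  · convert hz using 1
    simp only [h, Complex.ofReal_one, div_one]
    ring
  · have ht := t.2
    have hr : (r : ℂ) ≠ 0 := by exact_mod_cast (by linarith : r ≠ 0)
    convert ofReal_mem (r := (1 - t) * r + t) (by nlinarith [ht.1, ht.2])
      (by nlinarith [ht.1, ht.2]) using 1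
    rw [Complex.norm_of_nonneg (by linarith), div_self hr]
    push_cast
    ring

/-- The wedge deformation retracts onto its circle. -/
theorem id_homotopic_radialProj :
    (ContinuousMap.id circleWedgeSegment).Homotopic (ofCircle.comp radialProj) := by
  refine ⟨⟨⟨fun p ↦ ⟨_, radial_segment_mem p.2.2 p.1⟩, ?_⟩, fun z ↦ ?_, fun z ↦ ?_⟩⟩
  · refine Continuous.subtype_mk ?_ _
    have : Continuous fun p : I × circleWedgeSegment ↦ (p.2 : ℂ) / ‖(p.2 : ℂ)‖ :=
      Continuous.div (by fun_prop) (by fun_prop) fun p ↦ by simpa using ne_zero p.2.2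
    fun_prop
  · ext1; simp
  · ext1; simp [ofCircle, coe_radialProj]

theorem homotopic_of_radialProj_homotopic {X : Type*} [TopologicalSpace X]
    {f g : C(X, circleWedgeSegment)}
    (h : (radialProj.comp f).Homotopic (radialProj.comp g)) : f.Homotopic g := by
  have key (f : C(X, circleWedgeSegment)) :
      f.Homotopic (ofCircle.comp (radialProj.comp f)) :=
    id_homotopic_radialProj.comp (.refl f)
  exact (key f).trans (((ContinuousMap.Homotopic.refl ofCircle).comp h).trans (key g).symm)

end circleWedgeSegment

open Set unitInterval

theorem Circle.homotopic_of_eq_exp_mul {X : Type*} [TopologicalSpace X] {u v : C(X, Circle)}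
    (ψ : C(X, ℝ)) (h : ∀ x, u x = Circle.exp (ψ x) * v x) : u.Homotopic v := by
  refine ContinuousMap.Homotopic.symm
    ⟨⟨⟨fun p ↦ Circle.exp (p.1 * ψ p.2) * v p.2, by fun_prop⟩, fun x ↦ ?_, fun x ↦ ?_⟩⟩
  · simp
  · simp [h]

/-- A map from `ℝ/ℤ` to the circle lifts to a continuous real angle on `[0, 1]`. -/
theorem AddCircle.exists_angle (u : C(AddCircle (1 : ℝ), Circle)) :
    ∃ θ : ℝ → ℝ, Continuous θ ∧ (∃ d : ℤ, θ 1 - θ 0 = 2 * Real.pi * d) ∧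
      ∀ x ∈ Icc (0 : ℝ) 1, u x = Circle.exp (θ x) := by
  obtain ⟨e, he⟩ : ∃ e, Circle.exp e = u 0 := ⟨_, Circle.exp_arg _⟩
  obtain ⟨Γ, hΓ, -⟩ := Circle.isAddQuotientCoveringMap_exp.isCoveringMap.exists_path_lifts
    ⟨fun t : I ↦ u ((t : ℝ) : AddCircle (1 : ℝ)), by
      exact u.continuous.comp ((AddCircle.continuous_mk' 1).comp continuous_subtype_val)⟩ e
    (by simp [he])
  have hθ (x : ℝ) (hx : x ∈ Icc (0 : ℝ) 1) :
      u x = Circle.exp (Set.IccExtend zero_le_one Γ x) := by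
    rw [IccExtend_of_mem _ _ hx]
    exact (congrFun hΓ ⟨x, hx⟩).symm
  refine ⟨IccExtend zero_le_one Γ, Γ.continuous.Icc_extend', ?_, hθ⟩
  have h : Circle.exp (IccExtend zero_le_one Γ 1) = Circle.exp (IccExtend zero_le_one Γ 0) := by
    rw [← hθ 0 (by simp), ← hθ 1 (by simp), AddCircle.coe_period]
    simp
  obtain ⟨d, hd⟩ := Circle.exp_eq_exp.1 h
  exact ⟨d, by rw [hd]; ring⟩

/-- Circle-valued maps on `ℝ/ℤ` whose angles have the same total increment are homotopic. -/
theorem AddCircle.homotopic_of_angles {u v : C(AddCircle (1 : ℝ), Circle)} {θ φ : ℝ → ℝ}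
    (hθ : Continuous θ) (hφ : Continuous φ) (hd : θ 1 - θ 0 = φ 1 - φ 0)
    (hu : ∀ x ∈ Ico (0 : ℝ) 1, u x = Circle.exp (θ x))
    (hv : ∀ x ∈ Ico (0 : ℝ) 1, v x = Circle.exp (φ x)) : u.Homotopic v := by
  refine Circle.homotopic_of_eq_exp_mul ⟨AddCircle.liftIco 1 0 fun x ↦ θ x - φ x,
    AddCircle.liftIco_zero_continuous (by linarith) (by fun_prop)⟩ fun x ↦ ?_
  obtain ⟨a, ha, rfl⟩ := AddCircle.eq_coe_Ico x
  change u a = Circle.exp (AddCircle.liftIco 1 0 (fun x ↦ θ x - φ x) a) * v a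
  rw [AddCircle.liftIco_zero_coe_apply ha, hu a ha, hv a ha, ← Circle.exp_add, sub_add_cancel]

namespace circleWedgeSegment

/-- A `1`-periodic bump, `0` at the integers and `1` at distance `≥ 1/3` from them. -/
noncomputable def bump (y : ℝ) : ℝ := min 1 (3 * ‖(y : AddCircle (1 : ℝ))‖)

/-- A ramp from `0` to `1` that is constant off `[1/3, 2/3]`. -/
noncomputable def ramp (y : ℝ) : ℝ := max 0 (min 1 (3 * y - 1))

/-- The position along the line obtained by continuing the circle, cut open at `1`, by the
segment. The term `bump` pushes all but one of the `n` points of an orbit into the segment. -/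
noncomputable def position (n : ℕ) (x : ℝ) : ℝ := x + bump (max (n * x) 1)

/-- The angle of the coincidence-free loop: the point left on the circle makes `m` turns. -/
noncomputable def angle (n : ℕ) (m : ℤ) (x : ℝ) : ℝ :=
  2 * Real.pi * (min (position n x) 1 + m * ramp (n * x))

/-- The coincidence-free loop of degree `m + 1`, as a function on `[0, 1]`. -/
noncomputable def loop (n : ℕ) (m : ℤ) (x : ℝ) : ℂ :=
  (max (position n x) 1 : ℝ) * Circle.exp (angle n m x)

theorem continuous_bump : Continuous bump := by
  have : Continuous fun y : ℝ ↦ (y : AddCircle (1 : ℝ)) := AddCircle.continuous_mk' 1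
  unfold bump
  fun_prop

theorem bump_nonneg (y : ℝ) : 0 ≤ bump y := by unfold bump; positivity

theorem bump_le_one (y : ℝ) : bump y ≤ 1 := min_le_left _ _

theorem bump_add_intCast (y : ℝ) (l : ℤ) : bump (y + l) = bump y := by
  simp [bump]

theorem bump_intCast (l : ℤ) : bump l = 0 := by
  simpa [bump] using bump_add_intCast 0 l

theorem ramp_eq_one {y : ℝ} (hy : 1 ≤ y) : ramp y = 1 := by
  rw [ramp, min_eq_left (by linarith), max_eq_right zero_le_one]

theorem ramp_eq_zero_or_one {y : ℝ} (hy : bump y < 1) : ramp y = 0 ∨ ramp y = 1 := by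
  by_contra! h
  have h₁ : 1 / 3 < y := by
    by_contra! h'
    exact h.1 (max_eq_left (min_le_of_right_le (by linarith)))
  have h₂ : y < 2 / 3 := by
    by_contra! h'
    exact h.2 (by rw [ramp, min_eq_left (by linarith), max_eq_right zero_le_one])
  refine hy.not_ge (le_min le_rfl ?_)
  rw [UnitAddCircle.norm_eq]
  rcases le_or_gt (round y) 0 with hr | hr
  · have : (round y : ℝ) ≤ 0 := by exact_mod_cast hr
    linarith [le_abs_self (y - round y)]
  · have : (1 : ℝ) ≤ round y := by exact_mod_cast hr
    linarith [neg_le_abs (y - round y)]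

theorem continuous_position (n : ℕ) : Continuous (position n) := by
  have := continuous_bump
  unfold position
  fun_prop

theorem continuous_angle (n : ℕ) (m : ℤ) : Continuous (angle n m) := by
  have := continuous_position n
  unfold angle ramp
  fun_prop

theorem continuous_loop (n : ℕ) (m : ℤ) : Continuous (loop n m) := by
  have := continuous_position n
  have := continuous_angle n m
  unfold loop
  fun_prop

theorem le_position (n : ℕ) (x : ℝ) : x ≤ position n x :=
  le_add_of_nonneg_right (bump_nonneg _)

theorem norm_loop (n : ℕ) (m : ℤ) (x : ℝ) : ‖loop n m x‖ = max (position n x) 1 := by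
  rw [loop, norm_mul, Circle.norm_coe, mul_one, Complex.norm_of_nonneg (by positivity)]

theorem angle_zero (n : ℕ) (m : ℤ) : angle n m 0 = 0 := by
  have := bump_intCast 1
  simp_all [angle, position, ramp]

theorem position_one {n : ℕ} (hn : 1 ≤ n) : position n 1 = 1 := by
  have h := bump_intCast n
  have hn : (1 : ℝ) ≤ n := by exact_mod_cast hn
  simp_all [position]

theorem angle_one {n : ℕ} (hn : 1 ≤ n) (m : ℤ) : angle n m 1 = 2 * Real.pi * (1 + m) := by
  simp [angle, position_one hn, ramp_eq_one (y := n) (by exact_mod_cast hn)]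

theorem loop_zero (n : ℕ) (m : ℤ) : loop n m 0 = 1 := by
  have := bump_intCast 1
  simp_all [loop, angle_zero, position]

theorem exp_two_pi_mul_int (k : ℤ) : Circle.exp (2 * Real.pi * k) = 1 :=
  Circle.exp_eq_one.2 ⟨k, by ring⟩

theorem loop_one {n : ℕ} (hn : 1 ≤ n) (m : ℤ) : loop n m 1 = 1 := by
  have := exp_two_pi_mul_int (1 + m)
  push_cast at this
  simp [loop, angle_one hn, position_one hn, this]

theorem loop_mem {n : ℕ} (m : ℤ) {x : ℝ} (hx : x ∈ Icc (0 : ℝ) 1) :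
    loop n m x ∈ circleWedgeSegment := by
  rcases le_or_gt (position n x) 1 with h | h
  · exact Or.inl (by rw [mem_ofPred_eq, norm_loop, max_eq_right h])
  · have hnx : 1 ≤ (n : ℝ) * x := by
      by_contra! h'
      have := bump_intCast 1
      rw [position, max_eq_right h'.le] at h
      simp_all only [Int.cast_one, add_zero]
      exact h.not_ge hx.2
    have := exp_two_pi_mul_int (1 + m)
    push_cast at this
    rw [loop, angle, ramp_eq_one hnx, min_eq_right h.le, max_eq_left h.le, mul_one, this,
      Circle.coe_one, mul_one]
    exact ofReal_mem h.le (by unfold position; linarith [bump_le_one (max (n * x) 1), hx.2])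

/-- The loop separates distinct points of `[0, 1)` in the same `ℤₙ`-orbit. -/
theorem loop_ne_loop {n : ℕ} (hn : 1 ≤ n) (m : ℤ) {a b : ℝ} (ha : 0 ≤ a) (hab : a < b)
    (hb : b < 1) {l : ℤ} (hl : n * b = n * a + l) : loop n m a ≠ loop n m b := by
  intro heq
  have hn₀ : (0 : ℝ) < n := by exact_mod_cast hn
  have hl₁ : (1 : ℝ) ≤ l := by
    have : (0 : ℝ) < l := by nlinarith
    exact_mod_cast this
  have hna : 0 ≤ n * a := by positivity
  have hnb : 1 ≤ n * b := by linarith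
  have hposb : position n b = b + bump (n * a) := by
    rw [position, max_eq_left hnb, hl, bump_add_intCast]
  have hposa : position n a ≤ a + bump (n * a) := by
    rw [position]
    rcases le_total (n * a) 1 with h | h
    · have := bump_intCast 1
      rw [max_eq_right h]
      simp_all [bump_nonneg]
    · rw [max_eq_left h]
  have hlt : position n a < position n b := by linarith
  have hnorm := congrArg norm heq
  rw [norm_loop, norm_loop] at hnorm
  have hb₁ : position n b ≤ 1 := by
    by_contra! h
    rw [max_eq_left h.le] at hnorm
    exact (max_lt hlt h).ne hnorm
  have ha₁ : position n a ≤ 1 := hlt.le.trans hb₁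
  rw [loop, loop, max_eq_right ha₁, max_eq_right hb₁, Complex.ofReal_one, one_mul, one_mul,
    Circle.coe_inj, Circle.exp_eq_exp] at heq
  obtain ⟨k, hk⟩ := heq
  have hk' : position n a + m * ramp (n * a) = position n b + m + k := by
    rw [angle, angle, min_eq_left ha₁, min_eq_left hb₁, ramp_eq_one hnb] at hk
    have : 2 * Real.pi * (position n a + m * ramp (n * a)) =
        2 * Real.pi * (position n b + m + k) := by linarith
    exact mul_left_cancel₀ Real.two_pi_pos.ne' this
  obtain ⟨j, hj⟩ : ∃ j : ℤ, position n b - position n a = j := by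
    rcases ramp_eq_zero_or_one (y := n * a) (by linarith) with h | h
    · exact ⟨-m - k, by push_cast; rw [h] at hk'; linarith⟩
    · exact ⟨-k, by push_cast; rw [h] at hk'; linarith⟩
  have hj₁ : (1 : ℝ) ≤ j := by
    have : (0 : ℝ) < j := by linarith
    exact_mod_cast this
  have ha₀ : a = 0 := by linarith [le_position n a]
  have hbump : bump (n * a) = 0 := by simpa [ha₀] using bump_intCast 0
  linarith [le_position n a]

/-- The coincidence-free loop as a map from `ℝ/ℤ` to the wedge. -/
theorem exists_loop {n : ℕ} (hn : 1 ≤ n) (m : ℤ) :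
    ∃ g : C(AddCircle (1 : ℝ), circleWedgeSegment),
      ∀ x ∈ Ico (0 : ℝ) 1, (g x : ℂ) = loop n m x := by
  have hg (x : AddCircle (1 : ℝ)) :
      AddCircle.liftIco 1 0 (loop n m) x ∈ circleWedgeSegment := by
    obtain ⟨a, ha, rfl⟩ := AddCircle.eq_coe_Ico x
    rw [AddCircle.liftIco_zero_coe_apply ha]
    exact loop_mem m (Ico_subset_Icc_self ha)
  exact ⟨⟨fun x ↦ ⟨_, hg x⟩, (AddCircle.liftIco_zero_continuous
    (by rw [loop_zero, loop_one hn]) (continuous_loop n m).continuousOn).subtype_mk _⟩,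
    fun x hx ↦ AddCircle.liftIco_zero_coe_apply (f := loop n m) hx⟩

end circleWedgeSegment

open circleWedgeSegment

/-- Let `Y ⊆ ℂ` be the wedge `S¹ ∨ I` (unit circle together with the segment
`[1, 2]` on the real axis) and let `S = ℝ/ℤ` carry the free `ℤₙ`-action by rotations
`x ↦ x + k/n` (`n ≥ 2`). Then every continuous map `f : S → Y` is homotopic to a continuous
map `g` that is coincidence-free: `g (x + k/n) ≠ g x` for all `x` and all `1 ≤ k ≤ n - 1`. -/
theorem borsukUlam_fails_for_circle_to_wedge
    (n : ℕ) (hn : 2 ≤ n)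
    (Y : Set ℂ)
    (hY : Y = {z : ℂ | ‖z‖ = 1} ∪
        {z : ℂ | z.im = 0 ∧ 1 ≤ z.re ∧ z.re ≤ 2})
    (f : C(AddCircle (1 : ℝ), Y)) :
    ∃ g : C(AddCircle (1 : ℝ), Y), f.Homotopic g ∧
      ∀ (x : AddCircle (1 : ℝ)) (k : ℤ), 1 ≤ k → k ≤ (n : ℤ) - 1 →
        g (x + (((k : ℝ) / (n : ℝ) : ℝ) : AddCircle (1 : ℝ))) ≠ g x := by
  obtain rfl : Y = circleWedgeSegment := hY
  have hn₁ : 1 ≤ n := by omega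
  have hn₀ : (n : ℝ) ≠ 0 := by positivity
  obtain ⟨θ, hθ, ⟨d, hd⟩, hfθ⟩ := AddCircle.exists_angle (radialProj.comp f)
  obtain ⟨g, hg⟩ := exists_loop hn₁ (d - 1)
  refine ⟨g, homotopic_of_radialProj_homotopic (AddCircle.homotopic_of_angles hθ
    (continuous_angle n (d - 1)) ?_ (fun x hx ↦ hfθ x (Ico_subset_Icc_self hx))
    fun x hx ↦ ?_), fun x k hk₁ hk₂ heq ↦ ?_⟩
  · rw [hd, angle_one hn₁, angle_zero]
    push_cast
    ring
  · have h₀ : ((max (position n x) 1 : ℝ) : ℂ) ≠ 0 := by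
      exact_mod_cast (lt_max_of_lt_right one_pos).ne'
    ext1
    rw [ContinuousMap.comp_apply, coe_radialProj, hg x hx, norm_loop, loop,
      mul_div_cancel_left₀ _ h₀]
  · obtain ⟨a, ha, rfl⟩ := AddCircle.eq_coe_Ico x
    obtain ⟨b, hb, hab⟩ := AddCircle.eq_coe_Ico
      ((a : AddCircle (1 : ℝ)) + ((k / n : ℝ) : AddCircle (1 : ℝ)))
    rw [← hab] at heq
    have heq' : loop n (d - 1) b = loop n (d - 1) a := by
      rw [← hg a ha, ← hg b hb, heq]
    rw [← AddCircle.coe_add, ← sub_eq_zero, ← AddCircle.coe_sub, AddCircle.coe_eq_zero_iff] at hab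
    obtain ⟨j, hj⟩ := hab
    have hl : n * b = n * a + (k + n * j : ℤ) := by
      rw [zsmul_one, eq_sub_iff_add_eq] at hj
      rw [← hj]
      push_cast
      field_simp
      ring
    rcases lt_trichotomy a b with h | rfl | h
    · exact loop_ne_loop hn₁ (d - 1) ha.1 h hb.2 hl heq'.symm
    · have hkn : k + n * j = 0 := by
        exact_mod_cast left_eq_add.1 hl
      have hdvd : (n : ℤ) ∣ k := ⟨-j, by linarith⟩
      have := Int.le_of_dvd (by omega) hdvd
      omega
    · exact loop_ne_loop hn₁ (d - 1) hb.1 h ha.2 (l := -(k + n * j))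
        (by rw [hl]; push_cast; ring) heq'
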